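/- arXiv:1601.01243 — 2 statements merged into one kernel-verified Lean document; each statement's English description precedes it below -/
import Mathlib

section
/- Let s ∈ (6,8), let p : ℝ⁶ → ℝ be defined by p(z) = 1/(1+|z|^s), and let G : ℝ⁶ → ℝ be defined by G(z) = (2π)^{−3/2} exp(−|z|²/2). Then p is integrable on ℝ⁶, the function z ↦ p(z)·ln(p(z)/G(z)) − p(z) + G(z) is nonnegative on ℝ⁶, and its Lebesgue integral over ℝ⁶ equals +∞; that is, the relative entropy H(p|G) of p with respect to G is infinite. -/
open MeasureTheory Real

theorem relative_entropy_integrand_nonneg {a b : ℝ} (ha : 0 < a) (hb : 0 < b) :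
    0 ≤ a * Real.log (a / b) - a + b := by
  have h := Real.one_sub_inv_le_log_of_pos (div_pos ha hb)
  have h2 := mul_le_mul_of_nonneg_left h ha.le
  have h3 : a * (1 - (a / b)⁻¹) = a - b := by field_simp
  linarith

theorem integrable_one_div_one_add_norm_rpow {E : Type*} [NormedAddCommGroup E]
    [NormedSpace ℝ E] [FiniteDimensional ℝ E] [MeasurableSpace E] [BorelSpace E]
    (μ : Measure E) [μ.IsAddHaarMeasure] {s : ℝ} (hs : (Module.finrank ℝ E : ℝ) < s)
    (hs1 : 1 ≤ s) : Integrable (fun z : E => 1 / (1 + ‖z‖ ^ s)) μ := by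
  refine ((integrable_one_add_norm (μ := μ) hs).const_mul (2 ^ (s - 1))).mono'
    (Measurable.aestronglyMeasurable (by fun_prop)) (ae_of_all _ fun z => ?_)
  have h0 : 0 ≤ ‖z‖ ^ s := by positivity
  have h : (1 + ‖z‖) ^ s ≤ 2 ^ (s - 1) * (1 ^ s + ‖z‖ ^ s) := by
    exact_mod_cast NNReal.rpow_add_le_mul_rpow_add_rpow 1 ‖z‖₊ hs1
  rw [one_rpow] at h
  rw [Real.norm_of_nonneg (by positivity), rpow_neg (by positivity), ← div_eq_mul_inv,
    div_le_div_iff₀ (by positivity) (by positivity)]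
  linarith

theorem rpow_le_relative_entropy_integrand {s c r : ℝ} (hs : s ∈ Set.Ioo (0 : ℝ) 8) (hc : 0 < c)
    (hc1 : c ≤ 1) (hr : 40 ≤ r) :
    r ^ (2 - s) / 8 ≤ 1 / (1 + r ^ s) *
      Real.log (1 / (1 + r ^ s) / (c * Real.exp (-r ^ 2 / 2))) - 1 / (1 + r ^ s)
      + c * Real.exp (-r ^ 2 / 2) := by
  obtain ⟨hs0, hs8⟩ := hs
  have hr0 : 0 < r := by linarith
  have hrs : 1 ≤ r ^ s := Real.one_le_rpow (by linarith) hs0.le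
  have hlog : Real.log (1 / (1 + r ^ s) / (c * Real.exp (-r ^ 2 / 2)))
      = r ^ 2 / 2 - Real.log c - Real.log (1 + r ^ s) := by
    rw [Real.log_div (by positivity) (by positivity), Real.log_mul hc.ne' (by positivity),
      Real.log_exp, one_div, Real.log_inv]
    ring
  have hlogc : Real.log c ≤ 0 := Real.log_nonpos hc.le hc1
  have hlog1 : Real.log (1 + r ^ s) ≤ 1 + 8 * r := by
    have h1 : Real.log (1 + r ^ s) ≤ Real.log (2 * r ^ s) :=
      Real.log_le_log (by positivity) (by linarith)
    rw [Real.log_mul (by norm_num) (by positivity), Real.log_rpow hr0] at h1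
    have h2 := Real.log_le_sub_one_of_pos hr0
    have h3 := Real.log_le_sub_one_of_pos (zero_lt_two (α := ℝ))
    have h4 : 0 ≤ Real.log r := Real.log_nonneg (by linarith)
    nlinarith
  have hexp : 0 < c * Real.exp (-r ^ 2 / 2) := by positivity
  have hpow : r ^ (2 - s) / 8 = 1 / (2 * r ^ s) * (r ^ 2 / 4) := by
    rw [Real.rpow_sub hr0, Real.rpow_two]
    field_simp
    norm_num
  have hp : 1 / (2 * r ^ s) ≤ 1 / (1 + r ^ s) :=
    one_div_le_one_div_of_le (by positivity) (by linarith)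
  have hp0 : 0 < 1 / (1 + r ^ s) := by positivity
  rw [hlog, hpow]
  calc 1 / (2 * r ^ s) * (r ^ 2 / 4) ≤ 1 / (1 + r ^ s) * (r ^ 2 / 4) := by gcongr
    _ ≤ 1 / (1 + r ^ s) * (r ^ 2 / 2 - Real.log c - Real.log (1 + r ^ s) - 1) := by
      gcongr
      nlinarith
    _ ≤ _ := by linarith

theorem not_integrable_indicator_norm_rpow {E : Type*} [NormedAddCommGroup E]
    [NormedSpace ℝ E] [FiniteDimensional ℝ E] [Nontrivial E] [MeasurableSpace E] [BorelSpace E]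
    (μ : Measure E) [μ.IsAddHaarMeasure] {R t : ℝ} (hR : 0 < R)
    (ht : -(Module.finrank ℝ E : ℝ) ≤ t) :
    ¬ Integrable (fun z : E => (Set.Ioi R).indicator (fun r : ℝ => r ^ t) ‖z‖) μ := by
  intro h
  have h1 := ((integrable_fun_norm_addHaar μ).mp h).mono_set (Set.Ioi_subset_Ioi hR.le)
  have h2 : IntegrableOn (fun r : ℝ => r ^ ((Module.finrank ℝ E : ℝ) - 1 + t)) (Set.Ioi R) := by
    refine h1.congr_fun (fun r hr => ?_) measurableSet_Ioi
    have hr0 : 0 < r := hR.trans hr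
    have hn : 1 ≤ Module.finrank ℝ E := Module.finrank_pos
    simp only [Set.indicator_of_mem hr, smul_eq_mul]
    rw [Real.rpow_add hr0, ← Real.rpow_natCast, Nat.cast_sub hn, Nat.cast_one]
  have h3 := (integrableOn_Ioi_rpow_iff hR).mp h2
  linarith

/-- **A smooth, rapidly decaying density with infinite relative entropy w.r.t. the
Gaussian.** For `s ∈ (6,8)`, `p(z) = 1/(1+|z|^s)` is integrable on `ℝ⁶`, the
relative-entropy integrand `p ln(p/G) − p + G` (with `G` the standard Gaussian)
is nonnegative, and its integral over `ℝ⁶` is `+∞`, i.e. `H(p|G) = ∞`. -/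
theorem infinite_relative_entropy_example (s : ℝ) (hs : s ∈ Set.Ioo (6 : ℝ) 8)
    (p G : EuclideanSpace ℝ (Fin 6) → ℝ)
    (hp : ∀ z, p z = 1 / (1 + ‖z‖ ^ s))
    (hG : ∀ z, G z = (2 * π) ^ (-(3 : ℝ) / 2) * Real.exp (-‖z‖ ^ 2 / 2)) :
    Integrable p ∧
    (∀ z, 0 ≤ p z * Real.log (p z / G z) - p z + G z) ∧
    (∫⁻ z, ENNReal.ofReal (p z * Real.log (p z / G z) - p z + G z) = ⊤) := by
  obtain ⟨hs6, hs8⟩ := hs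
  have hnonneg : ∀ z, 0 ≤ p z * Real.log (p z / G z) - p z + G z := fun z =>
    relative_entropy_integrand_nonneg (by rw [hp]; positivity) (by rw [hG]; positivity)
  obtain rfl : p = fun z => 1 / (1 + ‖z‖ ^ s) := funext hp
  obtain rfl : G = fun z => (2 * π) ^ (-(3 : ℝ) / 2) * Real.exp (-‖z‖ ^ 2 / 2) := funext hG
  refine ⟨integrable_one_div_one_add_norm_rpow volume (by simpa using hs6) (by linarith),
    hnonneg, ?_⟩
  by_contra htop
  have hint := (lintegral_ofReal_ne_top_iff_integrable
    (Measurable.aestronglyMeasurable (by fun_prop)) (ae_of_all _ hnonneg)).mp htop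
  refine not_integrable_indicator_norm_rpow (E := EuclideanSpace ℝ (Fin 6)) volume
    (R := 40) (t := 2 - s) (by norm_num) (by simp; linarith) ?_
  refine (hint.const_mul 8).mono' (Measurable.aestronglyMeasurable ?_) (ae_of_all _ fun z => ?_)
  · exact (Measurable.indicator (by fun_prop) measurableSet_Ioi).comp measurable_norm
  · by_cases hz : ‖z‖ ∈ Set.Ioi (40 : ℝ)
    · rw [Set.indicator_of_mem hz, Real.norm_of_nonneg (by positivity)]
      have hc1 : (2 * π) ^ (-(3 : ℝ) / 2) ≤ 1 :=
        Real.rpow_le_one_of_one_le_of_nonpos (by linarith [pi_gt_three]) (by norm_num)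
      have := rpow_le_relative_entropy_integrand (s := s) ⟨by linarith, hs8⟩ (by positivity) hc1
        (le_of_lt hz)
      linarith
    · rw [Set.indicator_of_notMem hz, norm_zero]
      exact mul_nonneg (by norm_num) (hnonneg z)
end

section
/- Let s > 4 and c > 0, and let F : ℝ³ → ℝ be measurable with |F(v)| ≤ c(1+|v|)^{−s} for all v ∈ ℝ³. Then there is a finite constant C > 0, depending only on s, such that for every v ∈ ℝ³ the integrand (v_*,σ) ↦ (F(ṽ)F(ṽ_*) − F(v)F(v_*))|v−v_*| is absolutely integrable over ℝ³ × S² and |Q^S(F,F)(v)| ≤ C c² (1+|v|). -/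
open MeasureTheory

/-- Surface measure on the unit sphere `S² ⊂ ℝ³`. -/
noncomputable def sphereMeasure3 :
    Measure (Metric.sphere (0 : EuclideanSpace ℝ (Fin 3)) 1) :=
  (volume : Measure (EuclideanSpace ℝ (Fin 3))).toSphere

/-- The integrand of the hard-sphere Boltzmann collision operator. -/
noncomputable def collisionIntegrand (F : EuclideanSpace ℝ (Fin 3) → ℝ)
    (v : EuclideanSpace ℝ (Fin 3))
    (p : EuclideanSpace ℝ (Fin 3) × Metric.sphere (0 : EuclideanSpace ℝ (Fin 3)) 1) : ℝ :=
  (F ((1 / 2 : ℝ) • (v + p.1) + (‖v - p.1‖ / 2) • (p.2 : EuclideanSpace ℝ (Fin 3))) *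
      F ((1 / 2 : ℝ) • (v + p.1) - (‖v - p.1‖ / 2) • (p.2 : EuclideanSpace ℝ (Fin 3))) -
    F v * F p.1) * ‖v - p.1‖

/-- The hard-sphere Boltzmann collision operator on `ℝ³`. -/
noncomputable def Qcoll (F : EuclideanSpace ℝ (Fin 3) → ℝ)
    (v : EuclideanSpace ℝ (Fin 3)) : ℝ :=
  ∫ p, collisionIntegrand F v p
    ∂((volume : Measure (EuclideanSpace ℝ (Fin 3))).prod sphereMeasure3)

/-- The parallelogram law for the post-collisional velocities (conservation of energy). -/
lemma norm_sq_collision_add {E : Type*} [NormedAddCommGroup E] [InnerProductSpace ℝ E]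
    (v w σ : E) (hσ : ‖σ‖ = 1) :
    ‖(1 / 2 : ℝ) • (v + w) + (‖v - w‖ / 2) • σ‖ ^ 2 +
      ‖(1 / 2 : ℝ) • (v + w) - (‖v - w‖ / 2) • σ‖ ^ 2 = ‖v‖ ^ 2 + ‖w‖ ^ 2 := by
  have h1 := parallelogram_law_with_norm ℝ ((1 / 2 : ℝ) • (v + w)) ((‖v - w‖ / 2) • σ)
  have h2 := parallelogram_law_with_norm ℝ v w
  rw [norm_smul, norm_smul, hσ, Real.norm_of_nonneg (by norm_num),
    Real.norm_of_nonneg (by positivity)] at h1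
  linarith

lemma abs_mul_le_of_norm_sq_add_eq {E : Type*} [NormedAddCommGroup E] {s c : ℝ} (hs : 0 ≤ s)
    {F : E → ℝ} (hF : ∀ v, |F v| ≤ c * (1 + ‖v‖) ^ (-s)) {v w a b : E}
    (h : ‖a‖ ^ 2 + ‖b‖ ^ 2 = ‖v‖ ^ 2 + ‖w‖ ^ 2) :
    |F a * F b| ≤ c ^ 2 * (1 + ‖w‖) ^ (-s) := by
  have key : 1 + ‖w‖ ≤ (1 + ‖a‖) * (1 + ‖b‖) := by
    have hw : ‖w‖ ≤ ‖a‖ + ‖b‖ := by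
      refine le_of_sq_le_sq ?_ (by positivity)
      nlinarith [sq_nonneg ‖v‖, mul_nonneg (norm_nonneg a) (norm_nonneg b)]
    nlinarith [mul_nonneg (norm_nonneg a) (norm_nonneg b)]
  calc |F a * F b| = |F a| * |F b| := abs_mul _ _
    _ ≤ (c * (1 + ‖a‖) ^ (-s)) * (c * (1 + ‖b‖) ^ (-s)) :=
        mul_le_mul (hF a) (hF b) (abs_nonneg _) ((abs_nonneg _).trans (hF a))
    _ = c ^ 2 * ((1 + ‖a‖) * (1 + ‖b‖)) ^ (-s) := by
        rw [Real.mul_rpow (by positivity) (by positivity)]; ring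
    _ ≤ c ^ 2 * (1 + ‖w‖) ^ (-s) := by
        gcongr c ^ 2 * ?_
        exact Real.rpow_le_rpow_of_nonpos (by positivity) key (by linarith)

lemma abs_collisionIntegrand_le {s c : ℝ} (hs : 0 ≤ s) {F : EuclideanSpace ℝ (Fin 3) → ℝ}
    (hF : ∀ v, |F v| ≤ c * (1 + ‖v‖) ^ (-s)) (v : EuclideanSpace ℝ (Fin 3))
    (p : EuclideanSpace ℝ (Fin 3) × Metric.sphere (0 : EuclideanSpace ℝ (Fin 3)) 1) :
    |collisionIntegrand F v p| ≤ 2 * c ^ 2 * (1 + ‖v‖) * (1 + ‖p.1‖) ^ (-(s - 1)) := by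
  have hgain := abs_mul_le_of_norm_sq_add_eq hs hF
    (norm_sq_collision_add v p.1 p.2 (norm_eq_of_mem_sphere p.2))
  have hloss := abs_mul_le_of_norm_sq_add_eq hs hF (rfl : ‖v‖ ^ 2 + ‖p.1‖ ^ 2 = _)
  have hrel : ‖v - p.1‖ ≤ (1 + ‖v‖) * (1 + ‖p.1‖) := by
    nlinarith [norm_sub_le v p.1, mul_nonneg (norm_nonneg v) (norm_nonneg p.1)]
  have hpow : (1 + ‖p.1‖) ^ (-(s - 1)) = (1 + ‖p.1‖) ^ (-s) * (1 + ‖p.1‖) := by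
    rw [← Real.rpow_add_one (by positivity)]
    ring_nf
  rw [collisionIntegrand, abs_mul, abs_norm, hpow]
  calc _ ≤ (c ^ 2 * (1 + ‖p.1‖) ^ (-s) + c ^ 2 * (1 + ‖p.1‖) ^ (-s)) *
        ((1 + ‖v‖) * (1 + ‖p.1‖)) :=
        mul_le_mul ((abs_sub _ _).trans (add_le_add hgain hloss)) hrel (norm_nonneg _)
          (by positivity)
    _ = _ := by ring

lemma measurable_collisionIntegrand {F : EuclideanSpace ℝ (Fin 3) → ℝ} (hF : Measurable F)
    (v : EuclideanSpace ℝ (Fin 3)) : Measurable (collisionIntegrand F v) := by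
  unfold collisionIntegrand
  fun_prop

instance : IsFiniteMeasure sphereMeasure3 :=
  inferInstanceAs (IsFiniteMeasure (volume : Measure (EuclideanSpace ℝ (Fin 3))).toSphere)

/-- **Quadratic bound with linear growth for the collision operator** (used in
estimates (19)–(20) of the paper): if `|F(v)| ≤ c(1+|v|)^{−s}` with `s > 4`,
then the collision integrand is absolutely integrable and
`|Q^S(F,F)(v)| ≤ C c² (1+|v|)`, with `C` depending only on `s`. -/
theorem collision_operator_quadratic_bound (s : ℝ) (hs : 4 < s) :
    ∃ C > (0 : ℝ), ∀ c > (0 : ℝ), ∀ F : EuclideanSpace ℝ (Fin 3) → ℝ,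
      Measurable F → (∀ v, |F v| ≤ c * (1 + ‖v‖) ^ (-s)) →
      ∀ v : EuclideanSpace ℝ (Fin 3),
        Integrable (collisionIntegrand F v)
          ((volume : Measure (EuclideanSpace ℝ (Fin 3))).prod sphereMeasure3) ∧
        |Qcoll F v| ≤ C * c ^ 2 * (1 + ‖v‖) := by
  set μ := (volume : Measure (EuclideanSpace ℝ (Fin 3))).prod sphereMeasure3
  have hweight : Integrable (fun p : EuclideanSpace ℝ (Fin 3) ×
      Metric.sphere (0 : EuclideanSpace ℝ (Fin 3)) 1 ↦ (1 + ‖p.1‖) ^ (-(s - 1))) μ :=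
    (integrable_one_add_norm (by simp; linarith)).comp_fst _
  have hI : 0 ≤ ∫ p, (1 + ‖p.1‖) ^ (-(s - 1)) ∂μ := integral_nonneg fun p ↦ by positivity
  refine ⟨2 * ∫ p, (1 + ‖p.1‖) ^ (-(s - 1)) ∂μ + 1, by positivity, fun c hc F hFm hF v ↦ ?_⟩
  have hbound := abs_collisionIntegrand_le (by linarith) hF v
  have hdom := hweight.const_mul (2 * c ^ 2 * (1 + ‖v‖))
  refine ⟨hdom.mono' (measurable_collisionIntegrand hFm v).aestronglyMeasurable
    (.of_forall hbound), ?_⟩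
  calc |Qcoll F v| ≤ ∫ p, 2 * c ^ 2 * (1 + ‖v‖) * (1 + ‖p.1‖) ^ (-(s - 1)) ∂μ :=
        norm_integral_le_of_norm_le (f := collisionIntegrand F v) hdom (.of_forall hbound)
    _ = 2 * (∫ p, (1 + ‖p.1‖) ^ (-(s - 1)) ∂μ) * c ^ 2 * (1 + ‖v‖) := by
        rw [integral_const_mul]; ring
    _ ≤ _ := by gcongr; linarith
end
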